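/- For every n ≥ 2 and every X ∈ Y_{d,n}^B, tr_n(X t_n) = tr_n(t_n X). -/

import Mathlib

set_option maxHeartbeats 1000000
set_option synthInstance.maxHeartbeats 400000

noncomputable section

/-- The field `L = ℂ(u,v,z)` of rational functions in three indeterminates over `ℂ`. -/
abbrev Kf : Type := FractionRing (MvPolynomial (Fin 3) ℂ)

/-- The indeterminate `u`. -/
def uu : Kf := algebraMap (MvPolynomial (Fin 3) ℂ) Kf (MvPolynomial.X 0)

/-- The indeterminate `v`. -/
def vv : Kf := algebraMap (MvPolynomial (Fin 3) ℂ) Kf (MvPolynomial.X 1)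

/-- The indeterminate `z`. -/
def zz : Kf := algebraMap (MvPolynomial (Fin 3) ℂ) Kf (MvPolynomial.X 2)

/-- Generators of the framization of the Hecke algebra of type B on `n` strands:
`b` is the generator `b₁`, `g i` is the braiding generator `g_{i+1}` (`i : Fin (n-1)`),
and `t j` is the framing generator `t_{j+1}` (`j : Fin n`). -/
inductive Gen (n : ℕ) : Type
  | b : Gen n
  | g : Fin (n - 1) → Gen n
  | t : Fin n → Gen n

/-- The free algebra on the generators. -/
abbrev FA (n : ℕ) : Type := FreeAlgebra Kf (Gen n)

/-- The generator `b₁` in the free algebra. -/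
def Bb (n : ℕ) : FA n := FreeAlgebra.ι Kf Gen.b

/-- The generator `g_i` (for `1 ≤ i ≤ n-1`) in the free algebra; junk value `1` out of range. -/
def Gg (n i : ℕ) : FA n :=
  if h : 1 ≤ i ∧ i ≤ n - 1 then FreeAlgebra.ι Kf (Gen.g ⟨i - 1, by omega⟩) else 1

/-- The generator `t_j` (for `1 ≤ j ≤ n`) in the free algebra; junk value `1` out of range. -/
def Tt (n j : ℕ) : FA n :=
  if h : 1 ≤ j ∧ j ≤ n then FreeAlgebra.ι Kf (Gen.t ⟨j - 1, by omega⟩) else 1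

/-- The element `e_i = (1/d) ∑_{m=0}^{d-1} t_i^m t_{i+1}^{d-m}` in the free algebra. -/
def eF (d n i : ℕ) : FA n :=
  (d : Kf)⁻¹ • ∑ m ∈ Finset.range d, Tt n i ^ m * Tt n (i + 1) ^ (d - m)

/-- The element `f₁ = (1/d) ∑_{m=0}^{d-1} t₁^m` in the free algebra. -/
def fF (d n : ℕ) : FA n :=
  (d : Kf)⁻¹ • ∑ m ∈ Finset.range d, Tt n 1 ^ m

/-- The action of the simple transposition `s_i` on indices: swaps `i` and `i+1`. -/
def sAct (i j : ℕ) : ℕ := if j = i then i + 1 else if j = i + 1 then i else j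

/-- The defining relations of the framization `Y_{d,n}^B` of the Hecke algebra of type B. -/
inductive YBrel (d n : ℕ) : FA n → FA n → Prop
  | gg : ∀ i j : ℕ, 1 ≤ i → i ≤ n - 1 → 1 ≤ j → j ≤ n - 1 → (i + 1 < j ∨ j + 1 < i) →
      YBrel d n (Gg n i * Gg n j) (Gg n j * Gg n i)
  | braid : ∀ i : ℕ, 1 ≤ i → i ≤ n - 2 →
      YBrel d n (Gg n i * Gg n (i + 1) * Gg n i) (Gg n (i + 1) * Gg n i * Gg n (i + 1))
  | bg : ∀ i : ℕ, 2 ≤ i → i ≤ n - 1 → YBrel d n (Bb n * Gg n i) (Gg n i * Bb n)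
  | bgbg : YBrel d n (Bb n * Gg n 1 * Bb n * Gg n 1) (Gg n 1 * Bb n * Gg n 1 * Bb n)
  | tt : ∀ i j : ℕ, 1 ≤ i → i ≤ n → 1 ≤ j → j ≤ n →
      YBrel d n (Tt n i * Tt n j) (Tt n j * Tt n i)
  | tg : ∀ i j : ℕ, 1 ≤ i → i ≤ n - 1 → 1 ≤ j → j ≤ n →
      YBrel d n (Tt n j * Gg n i) (Gg n i * Tt n (sAct i j))
  | tb : ∀ i : ℕ, 1 ≤ i → i ≤ n → YBrel d n (Tt n i * Bb n) (Bb n * Tt n i)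
  | td : ∀ i : ℕ, 1 ≤ i → i ≤ n → YBrel d n (Tt n i ^ d) 1
  | gsq : ∀ i : ℕ, 1 ≤ i → i ≤ n - 1 →
      YBrel d n (Gg n i ^ 2) (1 + (uu - uu⁻¹) • (eF d n i * Gg n i))
  | bsq : YBrel d n (Bb n ^ 2) (1 + (vv - vv⁻¹) • (fF d n * Bb n))

/-- The framization of the Hecke algebra of type B, `Y_{d,n}^B`. -/
abbrev YB (d n : ℕ) : Type := RingQuot (YBrel d n)

instance (d n : ℕ) : Ring (YB d n) := RingQuot.instRing (YBrel d n)

instance (d n : ℕ) : Algebra Kf (YB d n) := RingQuot.instAlgebra _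

instance (d n : ℕ) : Module Kf (YB d n) := Algebra.toModule

/-- The canonical projection from the free algebra onto `Y_{d,n}^B`. -/
def mkY (d n : ℕ) : FA n →ₐ[Kf] YB d n := RingQuot.mkAlgHom Kf (YBrel d n)

/-- The generator `b₁` of `Y_{d,n}^B`. -/
def bY (d n : ℕ) : YB d n := mkY d n (Bb n)

/-- The generator `g_i` of `Y_{d,n}^B`. -/
def gY (d n : ℕ) (i : ℕ) : YB d n := mkY d n (Gg n i)

/-- The generator `t_j` of `Y_{d,n}^B`. -/
def tY (d n : ℕ) (j : ℕ) : YB d n := mkY d n (Tt n j)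

/-- The idempotent `e_i` of `Y_{d,n}^B`. -/
def eY (d n : ℕ) (i : ℕ) : YB d n := mkY d n (eF d n i)

/-- The idempotent `f₁` of `Y_{d,n}^B`. -/
def fY (d n : ℕ) : YB d n := mkY d n (fF d n)

/-- The element `g_i⁻¹ = g_i - (u - u⁻¹) e_i`. -/
def gInv (d n i : ℕ) : YB d n := gY d n i - (uu - uu⁻¹) • eY d n i

/-- The elements `b_k := g_{k-1} ⋯ g_1 b_1 g_1⁻¹ ⋯ g_{k-1}⁻¹` for `2 ≤ k ≤ n`,
defined by `b_k = g_{k-1} b_{k-1} g_{k-1}⁻¹`; with `b_1` the generator `b₁`. -/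
def bk (d n : ℕ) : ℕ → YB d n
  | 0 => 1
  | 1 => bY d n
  | (k + 2) => gY d n (k + 1) * bk d n (k + 1) * gInv d n (k + 1)

/-- The descending product `g_{k-1} g_{k-2} ⋯ g_j`. -/
def gRange (d n j k : ℕ) : YB d n := (((List.range' j (k - j)).reverse).map (gY d n)).prod

/-- The elements `𝔪⁺_{k,j,m}`: `𝔪⁺_{k,k,m} = t_k^m` and
`𝔪⁺_{k,j,m} = g_{k-1} ⋯ g_j t_j^m` for `j < k`. -/
def mPlus (d n k j m : ℕ) : YB d n :=
  if j = k then tY d n k ^ m else gRange d n j k * tY d n j ^ m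

/-- The elements `𝔪⁻_{k,j,m}`: `𝔪⁻_{k,k,m} = t_k^m b_k` and
`𝔪⁻_{k,j,m} = g_{k-1} ⋯ g_j b_j t_j^m` for `j < k`. -/
def mMinus (d n k j m : ℕ) : YB d n :=
  if j = k then tY d n k ^ m * bk d n k else gRange d n j k * (bk d n j * tY d n j ^ m)

/-- The subsets `M_{d,k}` of `Y_{d,n}^B`:
`M_{d,1} = {t₁^m, t₁^m b₁}` and `M_{d,k} = {t_k^m, t_k^m b_k, g_{k-1} x : x ∈ M_{d,k-1}}`. -/
def Mset (d n : ℕ) : ℕ → Set (YB d n)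
  | 0 => {1}
  | 1 => {x | ∃ m ≤ d - 1, x = tY d n 1 ^ m ∨ x = tY d n 1 ^ m * bY d n}
  | (k + 2) => {x |
      (∃ m ≤ d - 1, x = tY d n (k + 2) ^ m ∨ x = tY d n (k + 2) ^ m * bk d n (k + 2)) ∨
      ∃ y ∈ Mset d n (k + 1), x = gY d n (k + 1) * y}

/-- The set `𝖢_n` of all products `𝔪_1 𝔪_2 ⋯ 𝔪_n` with `𝔪_i ∈ M_{d,i}`. -/
def Cset (d n : ℕ) : Set (YB d n) :=
  {x | ∃ f : Fin n → YB d n, (∀ i : Fin n, f i ∈ Mset d n (i.val + 1)) ∧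
    x = (List.ofFn f).prod}

/-- Characterization of the natural inclusion `Y_{d,n}^B ⊆ Y_{d,n+1}^B`:
the algebra map sending generators to the generators of the same name. -/
def IsIncl (d n : ℕ) (inc : YB d n →ₐ[Kf] YB d (n + 1)) : Prop :=
  inc (bY d n) = bY d (n + 1) ∧
  (∀ i, 1 ≤ i → i ≤ n - 1 → inc (gY d n i) = gY d (n + 1) i) ∧
  (∀ j, 1 ≤ j → j ≤ n → inc (tY d n j) = tY d (n + 1) j)

/-- Characterization of the relative trace `tr_{n+1} : Y_{d,n+1}^B → Y_{d,n}^B`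
(with respect to trace parameters `x`, `y`): it is the `L`-linear map defined on the
basis `𝖢_{n+1}` by `tr(w t_{n+1}^m) = x_m w`, `tr(w b_{n+1} t_{n+1}^m) = y_m w`, and
`tr(w 𝔪^±_{n+1,k,m}) = z (w 𝔪^±_{n,k,m})` for `k < n+1`, where `w ∈ 𝖢_n`. -/
def IsRelTrace (d : ℕ) (x y : ZMod d → Kf) (n : ℕ)
    (inc : YB d n →ₐ[Kf] YB d (n + 1)) (tr : YB d (n + 1) →ₗ[Kf] YB d n) : Prop :=
  ∀ w ∈ Cset d n, ∀ m : ℕ, m ≤ d - 1 →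
    (tr (inc w * tY d (n + 1) (n + 1) ^ m) = x (m : ZMod d) • w) ∧
    (tr (inc w * (bk d (n + 1) (n + 1) * tY d (n + 1) (n + 1) ^ m)) = y (m : ZMod d) • w) ∧
    (∀ k, 1 ≤ k → k ≤ n →
      tr (inc w * mPlus d (n + 1) (n + 1) k m) = zz • (w * mPlus d n n k m) ∧
      tr (inc w * mMinus d (n + 1) (n + 1) k m) = zz • (w * mMinus d n n k m))

/-- Characterization of the trace `tr_1 : Y_{d,1}^B → L`:
`tr_1(t₁^a) = x_a` and `tr_1(b₁ t₁^a) = y_a`. -/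
def IsTr1 (d : ℕ) (x y : ZMod d → Kf) (tr1 : YB d 1 →ₗ[Kf] Kf) : Prop :=
  ∀ a : ℕ, a ≤ d - 1 →
    tr1 (tY d 1 1 ^ a) = x (a : ZMod d) ∧ tr1 (bY d 1 * tY d 1 1 ^ a) = y (a : ZMod d)

/-- The Markov trace tower `Tr_{m+1} = tr_1 ∘ tr_2 ∘ ⋯ ∘ tr_{m+1} : Y_{d,m+1}^B → L`,
built from the relative traces (`tr k` here is the relative trace
`tr_{k+2} : Y_{d,k+2}^B → Y_{d,k+1}^B`). -/
def TrT (d : ℕ) (tr1 : YB d 1 →ₗ[Kf] Kf)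
    (tr : (k : ℕ) → (YB d (k + 2) →ₗ[Kf] YB d (k + 1))) :
    (m : ℕ) → (YB d (m + 1) →ₗ[Kf] Kf)
  | 0 => tr1
  | (m + 1) => (TrT d tr1 tr m).comp (tr m)

section FramedRelations

variable {K R : Type*} [Field K] [Ring R] [Algebra K R]

/-- The defining relations of the framization of the Hecke algebra of type B on `N` strands, for
elements `g i` with inverses `gi i`, framing elements `t j` and conjugates `β k` of `β 1`. -/
structure FramedRels (d N : ℕ) (g gi t β : ℕ → R) (c c' : K) : Prop where
  one_le_d : 1 ≤ d
  comm_gg : ∀ i j, 1 ≤ i → i < N → 1 ≤ j → j < N → i + 1 < j → Commute (g i) (g j)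
  braid : ∀ i, 1 ≤ i → i + 1 < N → g i * g (i + 1) * g i = g (i + 1) * g i * g (i + 1)
  comm_bg : ∀ i, 2 ≤ i → i < N → Commute (β 1) (g i)
  bgbg : β 1 * g 1 * β 1 * g 1 = g 1 * β 1 * g 1 * β 1
  comm_tt : ∀ i j, 1 ≤ i → i ≤ N → 1 ≤ j → j ≤ N → Commute (t i) (t j)
  tg_self : ∀ i, 1 ≤ i → i < N → t i * g i = g i * t (i + 1)
  tg_succ : ∀ i, 1 ≤ i → i < N → t (i + 1) * g i = g i * t i
  comm_tg : ∀ i j, 1 ≤ i → i < N → 1 ≤ j → j ≤ N → j ≠ i → j ≠ i + 1 → Commute (t j) (g i)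
  comm_tb : ∀ j, 1 ≤ j → j ≤ N → Commute (t j) (β 1)
  t_pow : ∀ j, 1 ≤ j → j ≤ N → t j ^ d = 1
  g_gi : ∀ i, 1 ≤ i → i < N → g i * gi i = 1
  gi_g : ∀ i, 1 ≤ i → i < N → gi i * g i = 1
  gi_eq : ∀ i, 1 ≤ i → i < N →
    gi i = g i - c • ∑ m ∈ Finset.range d, t i ^ m * t (i + 1) ^ (d - m)
  b_sq : β 1 * β 1 = 1 + c' • ∑ m ∈ Finset.range d, t 1 ^ m * β 1
  β_succ : ∀ k, 1 ≤ k → β (k + 1) = g k * β k * gi k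

/-- The generators of the subalgebra on the first `k` strands. -/
def strandGens (g t : ℕ → R) (b : R) (k : ℕ) : Set R :=
  {x | (1 ≤ k ∧ x = b) ∨ (∃ i, 1 ≤ i ∧ i < k ∧ x = g i) ∨ ∃ j, 1 ≤ j ∧ j ≤ k ∧ x = t j}

variable (K) in
/-- The subalgebra on the first `k` strands. -/
def strandAlg (g t : ℕ → R) (b : R) (k : ℕ) : Subalgebra K R :=
  Algebra.adjoin K (strandGens g t b k)

variable (K) in
/-- The span of the products `a * g k * a'` with `a` and `a'` on the first `k` strands. -/
def strandBimod (g t : ℕ → R) (b : R) (k : ℕ) : Submodule K R :=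
  Submodule.span K
    {x | ∃ a ∈ strandAlg K g t b k, ∃ a' ∈ strandAlg K g t b k, x = a * g k * a'}

/-- The sets `M_{d,k}` for arbitrary families of elements. -/
def strandM (d : ℕ) (g t β : ℕ → R) : ℕ → Set R
  | 0 => {1}
  | 1 => {x | ∃ m ≤ d - 1, x = t 1 ^ m ∨ x = t 1 ^ m * β 1}
  | (k + 2) => {x |
      (∃ m ≤ d - 1, x = t (k + 2) ^ m ∨ x = t (k + 2) ^ m * β (k + 2)) ∨
      ∃ y ∈ strandM d g t β (k + 1), x = g (k + 1) * y}

lemma mul_mul_eq_of_mul_eq {a b c e : R} (h : a * b = c * e) (x : R) :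
    a * (b * x) = c * (e * x) := by
  rw [← mul_assoc, h, mul_assoc]

lemma mul_mul_cancel_of_mul_eq_one {a b : R} (h : a * b = 1) (x : R) : a * (b * x) = x := by
  rw [← mul_assoc, h, one_mul]

lemma mul_eq_mul_of_inverses {a a' x y : R} (h1 : a * a' = 1) (h2 : a' * a = 1)
    (h : x * a = a * y) : y * a' = a' * x := by
  calc y * a' = a' * a * y * a' := by rw [h2, one_mul]
    _ = a' * (x * a) * a' := by rw [h]; simp only [mul_assoc]
    _ = a' * x := by simp only [mul_assoc, h1, mul_one]

lemma adjoin_subset_of_mul_right_mem {s : Set R} {V : Submodule K R} (h1 : (1 : R) ∈ V)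
    (h : ∀ x ∈ V, ∀ y ∈ s, x * y ∈ V) {a : R} (ha : a ∈ Algebra.adjoin K s) : a ∈ V := by
  suffices H : ∀ x ∈ V, x * a ∈ V by simpa using H 1 h1
  induction ha using Algebra.adjoin_induction with
  | mem y hy => exact fun x hx => h x hx y hy
  | algebraMap r =>
    intro x hx
    rw [← Algebra.commutes, ← Algebra.smul_def]
    exact V.smul_mem r hx
  | add y z _ _ hy hz =>
    intro x hx
    rw [mul_add]
    exact V.add_mem (hy x hx) (hz x hx)
  | mul y z _ _ hy hz =>
    intro x hx
    rw [← mul_assoc]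
    exact hz _ (hy x hx)

lemma commute_of_mem_adjoin {s : Set R} {x : R} (h : ∀ y ∈ s, Commute x y) {a : R}
    (ha : a ∈ Algebra.adjoin K s) : Commute x a := by
  induction ha using Algebra.adjoin_induction with
  | mem y hy => exact h y hy
  | algebraMap r => exact (Algebra.commutes r x).symm
  | add y z _ _ hy hz => exact hy.add_right hz
  | mul y z _ _ hy hz => exact hy.mul_right hz

namespace FramedRels

variable {d N : ℕ} {g gi t β : ℕ → R} {c c' : K}

lemma commute_gi_of_commute_g (h : FramedRels d N g gi t β c c') {i : ℕ} (h1 : 1 ≤ i) (h2 : i < N)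
    {x : R} (hx : Commute x (g i)) : Commute x (gi i) :=
  mul_eq_mul_of_inverses (h.g_gi i h1 h2) (h.gi_g i h1 h2) hx

lemma t_succ_pow_g (h : FramedRels d N g gi t β c c') {i : ℕ} (h1 : 1 ≤ i) (h2 : i < N)
    (m : ℕ) : t (i + 1) ^ m * g i = g i * t i ^ m :=
  (SemiconjBy.pow_right (show SemiconjBy (g i) (t i) (t (i + 1)) from
    (h.tg_succ i h1 h2).symm) m).symm

lemma t_pow_g (h : FramedRels d N g gi t β c c') {i : ℕ} (h1 : 1 ≤ i) (h2 : i < N)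
    (m : ℕ) : t i ^ m * g i = g i * t (i + 1) ^ m :=
  (SemiconjBy.pow_right (show SemiconjBy (g i) (t (i + 1)) (t i) from
    (h.tg_self i h1 h2).symm) m).symm

lemma commute_gg (h : FramedRels d N g gi t β c c') {i j : ℕ} (h1 : 1 ≤ i) (h2 : i < N)
    (h3 : 1 ≤ j) (h4 : j < N) (h5 : i + 1 ≠ j) (h6 : j + 1 ≠ i) : Commute (g i) (g j) := by
  rcases lt_trichotomy i j with hij | rfl | hij
  · exact h.comm_gg i j h1 h2 h3 h4 (by omega)
  · exact Commute.refl _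
  · exact (h.comm_gg j i h3 h4 h1 h2 (by omega)).symm

lemma commute_t_β (h : FramedRels d N g gi t β c c') {k : ℕ} (hk1 : 1 ≤ k) (hk : k ≤ N) :
    ∀ j, 1 ≤ j → j ≤ N → Commute (t j) (β k) := by
  induction k, hk1 using Nat.le_induction with
  | base => exact h.comm_tb
  | succ k hk1 ih =>
    intro j hj1 hj
    have hkN : k < N := hk
    have ih := ih hkN.le
    rw [h.β_succ k hk1]
    have a1 := h.g_gi k hk1 hkN
    have a2 := h.gi_g k hk1 hkN
    by_cases hjk : j = k
    · subst hjk
      have e1 := h.tg_self j hk1 hkN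
      have e2 := mul_eq_mul_of_inverses a1 a2 (h.tg_succ j hk1 hkN)
      have e3 := (ih (j + 1) (by omega) (by omega)).eq
      show t j * (g j * β j * gi j) = g j * β j * gi j * t j
      have e4 := mul_eq_mul_of_inverses a1 a2 e1
      simp only [mul_assoc, mul_mul_eq_of_mul_eq e1, mul_mul_eq_of_mul_eq e3, e4]
    · by_cases hjk' : j = k + 1
      · subst hjk'
        have e1 := h.tg_succ k hk1 hkN
        have e3 := (ih k (by omega) (by omega)).eq
        show t (k + 1) * (g k * β k * gi k) = g k * β k * gi k * t (k + 1)
        have e4 := mul_eq_mul_of_inverses a1 a2 e1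
        simp only [mul_assoc, mul_mul_eq_of_mul_eq e1, mul_mul_eq_of_mul_eq e3, e4]
      · have e1 := h.comm_tg k j hk1 hkN hj1 hj hjk hjk'
        exact (e1.mul_right (ih j hj1 hj)).mul_right (h.commute_gi_of_commute_g hk1 hkN e1)

lemma g_gi_gi (h : FramedRels d N g gi t β c c') {i : ℕ} (h1 : 1 ≤ i) (h2 : i + 1 < N) :
    g (i + 1) * (gi i * gi (i + 1)) = gi i * (gi (i + 1) * g i) := by
  have a2 := h.gi_g i h1 (by omega)
  have a1 := h.g_gi i h1 (by omega)
  have b1 := h.g_gi (i + 1) (by omega) h2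
  have b2 := h.gi_g (i + 1) (by omega) h2
  have e : g i * (g (i + 1) * g i) = g (i + 1) * g i * g (i + 1) := by
    rw [← h.braid i h1 h2, mul_assoc]
  have p1 : (g (i + 1) * g i) * (gi i * gi (i + 1)) = 1 := by
    simp only [mul_assoc, mul_mul_cancel_of_mul_eq_one a1, b1]
  have p2 : (gi i * gi (i + 1)) * (g (i + 1) * g i) = 1 := by
    simp only [mul_assoc, mul_mul_cancel_of_mul_eq_one b2, a2]
  have := mul_eq_mul_of_inverses p1 p2 e
  simpa only [mul_assoc] using this

lemma g_g_gi (h : FramedRels d N g gi t β c c') {i : ℕ} (h1 : 1 ≤ i) (h2 : i + 1 < N) :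
    g (i + 1) * (g i * gi (i + 1)) = gi i * (g (i + 1) * g i) := by
  have a2 := h.gi_g i h1 (by omega)
  have b1 := h.g_gi (i + 1) (by omega) h2
  calc g (i + 1) * (g i * gi (i + 1))
      = gi i * (g i * (g (i + 1) * (g i * gi (i + 1)))) :=
        (mul_mul_cancel_of_mul_eq_one a2 _).symm
    _ = gi i * (g i * g (i + 1) * g i * gi (i + 1)) := by simp only [mul_assoc]
    _ = gi i * (g (i + 1) * g i) := by
        rw [h.braid i h1 h2]; simp only [mul_assoc, b1, mul_one]

lemma commute_g_β (h : FramedRels d N g gi t β c c') {k : ℕ} (hk1 : 1 ≤ k) (hk : k ≤ N) :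
    ∀ i, 1 ≤ i → i < N → i ≠ k → i + 1 ≠ k → Commute (g i) (β k) := by
  induction k using Nat.strong_induction_on with
  | h k ih =>
  intro i h1 h2 h3 h4
  obtain rfl | ⟨k, rfl⟩ : k = 1 ∨ ∃ l, k = l + 1 + 1 :=
    (Nat.lt_or_ge 1 k).symm.imp (fun hk' => by omega) fun hk' => ⟨k - 2, by omega⟩
  · exact (h.comm_bg i (by omega) h2).symm
  have hkN : k + 1 < N := hk
  rw [h.β_succ (k + 1) (by omega)]
  by_cases hik : i = k
  · subst hik
    rw [h.β_succ i h1]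
    have e1 : g i * (g (i + 1) * g i) = g (i + 1) * (g i * g (i + 1)) := by
      simpa only [mul_assoc] using h.braid i h1 hkN
    have e2 : Commute (g (i + 1)) (β i) :=
      ih i (by omega) h1 h2.le (i + 1) (by omega) hkN (by omega) (by omega)
    have e3 := h.g_gi_gi h1 hkN
    show _ = _
    calc g i * (g (i + 1) * (g i * β i * gi i) * gi (i + 1))
        = g i * (g (i + 1) * g i) * (β i * (gi i * gi (i + 1))) := by simp only [mul_assoc]
      _ = g (i + 1) * (g i * (g (i + 1) * (β i * (gi i * gi (i + 1))))) := by
          rw [e1]; simp only [mul_assoc]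
      _ = _ := by
          rw [mul_mul_eq_of_mul_eq e2.eq, e3]; simp only [mul_assoc]
  · have e1 : Commute (g i) (g (k + 1)) :=
      h.commute_gg h1 h2 (by omega) hkN (by omega) (by omega)
    exact (e1.mul_right (ih (k + 1) (by omega) (by omega) (by omega) i h1 h2 (by omega)
      (by omega))).mul_right (h.commute_gi_of_commute_g (by omega) hkN e1)


lemma strandAlg_mono (g t : ℕ → R) (b : R) {k l : ℕ} (hkl : k ≤ l) :
    strandAlg K g t b k ≤ strandAlg K g t b l := by
  refine Algebra.adjoin_mono ?_
  rintro x (⟨h1, rfl⟩ | ⟨i, h1, h2, rfl⟩ | ⟨j, h1, h2, rfl⟩)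
  · exact Or.inl ⟨by omega, rfl⟩
  · exact Or.inr (Or.inl ⟨i, h1, by omega, rfl⟩)
  · exact Or.inr (Or.inr ⟨j, h1, by omega, rfl⟩)

lemma b_mem (g t : ℕ → R) (b : R) {k : ℕ} (hk : 1 ≤ k) : b ∈ strandAlg K g t b k :=
  Algebra.subset_adjoin (Or.inl ⟨hk, rfl⟩)

lemma g_mem (g t : ℕ → R) (b : R) {i k : ℕ} (h1 : 1 ≤ i) (h2 : i < k) :
    g i ∈ strandAlg K g t b k :=
  Algebra.subset_adjoin (Or.inr (Or.inl ⟨i, h1, h2, rfl⟩))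

lemma t_mem (g t : ℕ → R) (b : R) {j k : ℕ} (h1 : 1 ≤ j) (h2 : j ≤ k) :
    t j ∈ strandAlg K g t b k :=
  Algebra.subset_adjoin (Or.inr (Or.inr ⟨j, h1, h2, rfl⟩))

lemma gi_mem (h : FramedRels d N g gi t β c c') {i k : ℕ} (h1 : 1 ≤ i) (h2 : i < k) (h3 : i < N) :
    gi i ∈ strandAlg K g t (β 1) k := by
  rw [h.gi_eq i h1 h3]
  refine sub_mem (g_mem g t _ h1 h2) (Subalgebra.smul_mem _ (sum_mem fun m _ => ?_) c)
  exact mul_mem (pow_mem (t_mem g t _ h1 h2.le) _) (pow_mem (t_mem g t _ (by omega) h2) _)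

lemma β_mem (h : FramedRels d N g gi t β c c') {j : ℕ} (h1 : 1 ≤ j) :
    ∀ {k : ℕ}, j ≤ k → j ≤ N → β j ∈ strandAlg K g t (β 1) k := by
  induction j, h1 using Nat.le_induction with
  | base => exact fun hk _ => b_mem g t _ hk
  | succ j hj ih =>
    intro k hk hN
    rw [h.β_succ j hj]
    exact mul_mem (mul_mem (g_mem g t _ hj hk) (ih (by omega) (by omega)))
      (h.gi_mem hj hk hN)

lemma commute_t_of_mem (h : FramedRels d N g gi t β c c') {j k : ℕ} (h1 : k < j) (h2 : j ≤ N)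
    {a : R} (ha : a ∈ strandAlg K g t (β 1) k) : Commute (t j) a := by
  refine commute_of_mem_adjoin ?_ ha
  rintro x (⟨h3, rfl⟩ | ⟨i, h3, h4, rfl⟩ | ⟨i, h3, h4, rfl⟩)
  · exact h.comm_tb j (by omega) h2
  · exact h.comm_tg i j h3 (by omega) (by omega) h2 (by omega) (by omega)
  · exact h.comm_tt j i (by omega) h2 h3 (by omega)

lemma commute_g_of_mem (h : FramedRels d N g gi t β c c') {j k : ℕ} (h1 : k < j) (h2 : j < N)
    {a : R} (ha : a ∈ strandAlg K g t (β 1) k) : Commute (g j) a := by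
  refine commute_of_mem_adjoin ?_ ha
  rintro x (⟨h3, rfl⟩ | ⟨i, h3, h4, rfl⟩ | ⟨i, h3, h4, rfl⟩)
  · exact (h.comm_bg j (by omega) h2).symm
  · exact (h.comm_gg i j h3 (by omega) (by omega) h2 (by omega)).symm
  · exact (h.comm_tg j i (by omega) h2 h3 (by omega) (by omega) (by omega)).symm

lemma strandM_subset (h : FramedRels d N g gi t β c c') {k : ℕ} (h1 : 1 ≤ k) (h2 : k ≤ N) :
    strandM d g t β k ⊆ strandAlg K g t (β 1) k := by
  induction k, h1 using Nat.le_induction with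
  | base =>
    rintro x ⟨m, -, rfl | rfl⟩
    · exact pow_mem (t_mem g t _ le_rfl le_rfl) _
    · exact mul_mem (pow_mem (t_mem g t _ le_rfl le_rfl) _) (b_mem g t _ le_rfl)
  | succ k hk ih =>
    obtain ⟨k, rfl⟩ : ∃ l, k = l + 1 := ⟨k - 1, by omega⟩
    rintro x (⟨m, -, rfl | rfl⟩ | ⟨y, hy, rfl⟩)
    · exact pow_mem (t_mem g t _ (by omega) le_rfl) _
    · exact mul_mem (pow_mem (t_mem g t _ (by omega) le_rfl) _)
        (h.β_mem (by omega) le_rfl h2)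
    · exact mul_mem (g_mem g t _ hk (by omega))
        (strandAlg_mono g t _ (by omega) (ih (by omega) hy))

lemma mul_g_mul_mem (g t : ℕ → R) (b : R) {k : ℕ} {a a' : R} (ha : a ∈ strandAlg K g t b k)
    (ha' : a' ∈ strandAlg K g t b k) : a * g k * a' ∈ strandBimod K g t b k :=
  Submodule.subset_span ⟨a, ha, a', ha', rfl⟩

lemma g_mul_mem (g t : ℕ → R) (b : R) {k : ℕ} {a' : R}
    (ha' : a' ∈ strandAlg K g t b k) : g k * a' ∈ strandBimod K g t b k := by
  simpa using mul_g_mul_mem g t b (one_mem _) ha'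

lemma strandBimod_induction {g t : ℕ → R} {b : R} {k : ℕ} {f : R →ₗ[K] R} {V : Submodule K R}
    (hf : ∀ a ∈ strandAlg K g t b k, ∀ a' ∈ strandAlg K g t b k, f (a * g k * a') ∈ V)
    {x : R} (hx : x ∈ strandBimod K g t b k) : f x ∈ V := by
  have : strandBimod K g t b k ≤ V.comap f := by
    refine Submodule.span_le.2 ?_
    rintro _ ⟨a, ha, a', ha', rfl⟩
    exact hf a ha a' ha'
  exact this hx

lemma strandBimod_mul_mem {g t : ℕ → R} {b : R} {k : ℕ} {x y : R}
    (hx : x ∈ strandBimod K g t b k) (hy : y ∈ strandAlg K g t b k) :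
    x * y ∈ strandBimod K g t b k := by
  refine strandBimod_induction (f := LinearMap.mulRight K y) (fun a ha a' ha' => ?_) hx
  rw [LinearMap.mulRight_apply, mul_assoc]
  exact mul_g_mul_mem g t b ha (mul_mem ha' hy)

lemma mul_strandBimod_mem {g t : ℕ → R} {b : R} {k : ℕ} {x y : R}
    (hx : x ∈ strandBimod K g t b k) (hy : y ∈ strandAlg K g t b k) :
    y * x ∈ strandBimod K g t b k := by
  refine strandBimod_induction (f := LinearMap.mulLeft K y) (fun a ha a' ha' => ?_) hx
  rw [LinearMap.mulLeft_apply, ← mul_assoc, ← mul_assoc]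
  exact mul_g_mul_mem g t b (mul_mem hy ha) ha'

lemma strandBimod_mul_t_pow_mem (h : FramedRels d N g gi t β c c') {k : ℕ} (h1 : 1 ≤ k)
    (h2 : k < N) {x : R} (hx : x ∈ strandBimod K g t (β 1) k) (m : ℕ) :
    x * t (k + 1) ^ m ∈ strandBimod K g t (β 1) k := by
  refine strandBimod_induction (f := LinearMap.mulRight K _) (fun a ha a' ha' => ?_) hx
  have e : a * g k * a' * t (k + 1) ^ m = a * t k ^ m * g k * a' := by
    have e1 := ((h.commute_t_of_mem (Nat.lt_succ_self k) h2 ha').pow_left m).eq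
    rw [mul_assoc, ← e1, ← mul_assoc, mul_assoc a, ← h.t_pow_g h1 h2]
    simp only [mul_assoc]
  rw [LinearMap.mulRight_apply, e]
  exact mul_g_mul_mem g t _ (mul_mem ha (pow_mem (t_mem g t _ h1 le_rfl) _)) ha'

lemma t_pow_mul_strandBimod_mem (h : FramedRels d N g gi t β c c') {k : ℕ} (h1 : 1 ≤ k)
    (h2 : k < N) {x : R} (hx : x ∈ strandBimod K g t (β 1) k) (m : ℕ) :
    t (k + 1) ^ m * x ∈ strandBimod K g t (β 1) k := by
  refine strandBimod_induction (f := LinearMap.mulLeft K _) (fun a ha a' ha' => ?_) hx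
  have e : t (k + 1) ^ m * (a * g k * a') = a * g k * (t k ^ m * a') := by
    have e1 := ((h.commute_t_of_mem (Nat.lt_succ_self k) h2 ha).pow_left m).eq
    rw [mul_assoc a, mul_mul_eq_of_mul_eq e1, mul_mul_eq_of_mul_eq (h.t_succ_pow_g h1 h2 m)]
    simp only [mul_assoc]
  rw [LinearMap.mulLeft_apply, e]
  exact mul_g_mul_mem g t _ ha (mul_mem (pow_mem (t_mem g t _ h1 le_rfl) _) ha')

lemma strandBimod_mul_sum_mem (h : FramedRels d N g gi t β c c') {k : ℕ} (h1 : 1 ≤ k)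
    (h2 : k < N) {x : R} (hx : x ∈ strandBimod K g t (β 1) k) :
    x * ∑ m ∈ Finset.range d, t k ^ m * t (k + 1) ^ (d - m) ∈ strandBimod K g t (β 1) k := by
  rw [Finset.mul_sum]
  refine sum_mem fun m _ => ?_
  rw [← mul_assoc]
  exact h.strandBimod_mul_t_pow_mem h1 h2
    (strandBimod_mul_mem hx (pow_mem (t_mem g t _ h1 le_rfl) _)) _

lemma commutator_mem (h : FramedRels d N g gi t β c c') {k : ℕ} (h1 : 1 ≤ k) (h2 : k < N) :
    β (k + 1) * β 1 - β 1 * β (k + 1) ∈ strandBimod K g t (β 1) k := by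
  induction k, h1 using Nat.le_induction with
  | base =>
    rw [h.β_succ 1 le_rfl, h.gi_eq 1 le_rfl h2]
    set E := ∑ m ∈ Finset.range d, t 1 ^ m * t (1 + 1) ^ (d - m) with hE
    have e : g 1 * β 1 * (g 1 - c • E) * β 1 - β 1 * (g 1 * β 1 * (g 1 - c • E)) =
        c • (β 1 * g 1 * β 1 * E) - c • (g 1 * β 1 * E * β 1) := by
      have e1 : g 1 * β 1 * (g 1 - c • E) * β 1 =
          g 1 * β 1 * g 1 * β 1 - c • (g 1 * β 1 * E * β 1) := by
        simp only [mul_sub, sub_mul, mul_smul_comm, smul_mul_assoc]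
      have e2 : β 1 * (g 1 * β 1 * (g 1 - c • E)) =
          β 1 * g 1 * β 1 * g 1 - c • (β 1 * g 1 * β 1 * E) := by
        simp only [mul_sub, mul_smul_comm, mul_assoc]
      rw [e1, e2, h.bgbg]
      abel
    rw [e]
    have hb : β 1 ∈ strandAlg K g t (β 1) 1 := b_mem g t _ le_rfl
    exact sub_mem
      (Submodule.smul_mem _ _ (h.strandBimod_mul_sum_mem le_rfl h2 (mul_g_mul_mem g t _ hb hb)))
      (Submodule.smul_mem _ _ (strandBimod_mul_mem
        (h.strandBimod_mul_sum_mem le_rfl h2 (g_mul_mem g t _ hb)) hb))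
  | succ k hk ih =>
    have hc : Commute (β 1) (g (k + 1)) := h.comm_bg _ (by omega) h2
    have hc' := h.commute_gi_of_commute_g (by omega) h2 hc
    have e : β (k + 1 + 1) * β 1 - β 1 * β (k + 1 + 1) =
        g (k + 1) * (β (k + 1) * β 1 - β 1 * β (k + 1)) * gi (k + 1) := by
      rw [h.β_succ (k + 1) (by omega)]
      simp only [mul_sub, sub_mul, mul_assoc, ← hc'.eq, mul_mul_eq_of_mul_eq hc.eq]
    rw [e]
    refine strandBimod_induction
      (f := (LinearMap.mulRight K (gi (k + 1))).comp (LinearMap.mulLeft K (g (k + 1))))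
      (fun a ha a' ha' => ?_) (ih (by omega))
    have e1 := h.commute_g_of_mem (Nat.lt_succ_self k) h2 ha
    have e2 := h.commute_gi_of_commute_g (by omega) h2
      (h.commute_g_of_mem (Nat.lt_succ_self k) h2 ha').symm
    have e3 : g (k + 1) * (a * g k * a') * gi (k + 1) =
        a * gi k * g (k + 1) * (g k * a') := by
      rw [mul_assoc, mul_assoc _ a', e2.eq, mul_assoc a, mul_mul_eq_of_mul_eq e1.eq]
      have := congrArg (fun y => a * (y * a')) (h.g_g_gi hk h2)
      simpa only [mul_assoc] using this
    simp only [LinearMap.comp_apply, LinearMap.mulLeft_apply, LinearMap.mulRight_apply]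
    rw [e3]
    refine mul_g_mul_mem g t _ (mul_mem (strandAlg_mono g t _ k.le_succ ha)
      (h.gi_mem hk (by omega) (by omega))) (mul_mem (g_mem g t _ hk (by omega))
      (strandAlg_mono g t _ k.le_succ ha'))

lemma t_pow_mod (h : FramedRels d N g gi t β c c') {j : ℕ} (h1 : 1 ≤ j) (h2 : j ≤ N) (m : ℕ) :
    ∃ m' ≤ d - 1, t j ^ m = t j ^ m' := by
  have := h.one_le_d
  have := Nat.mod_lt m h.one_le_d
  exact ⟨m % d, by omega, pow_eq_pow_mod m (h.t_pow j h1 h2)⟩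

variable (K) in
/-- The span of the products of an element on `k` strands with an element of `M_{d,k+1}`. -/
def strandProd (d : ℕ) (g t β : ℕ → R) (k : ℕ) : Submodule K R :=
  Submodule.span K
    {x | ∃ a ∈ strandAlg K g t (β 1) k, ∃ y ∈ strandM d g t β (k + 1), x = a * y}

lemma mul_strandM_mem {k : ℕ} {a x : R} (ha : a ∈ strandAlg K g t (β 1) k)
    (hx : x ∈ strandM d g t β (k + 1)) : a * x ∈ strandProd K d g t β k :=
  Submodule.subset_span ⟨a, ha, x, hx, rfl⟩

lemma strandProd_le {k : ℕ} {V : Submodule K R}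
    (hV : ∀ a ∈ strandAlg K g t (β 1) k, ∀ x ∈ strandM d g t β (k + 1), a * x ∈ V) :
    strandProd K d g t β k ≤ V := by
  refine Submodule.span_le.2 ?_
  rintro _ ⟨a, ha, x, hx, rfl⟩
  exact hV a ha x hx

lemma mul_strandProd_mem {k : ℕ} {a x : R} (ha : a ∈ strandAlg K g t (β 1) k)
    (hx : x ∈ strandProd K d g t β k) : a * x ∈ strandProd K d g t β k := by
  have : strandProd K d g t β k ≤ (strandProd K d g t β k).comap (LinearMap.mulLeft K a) := by
    refine strandProd_le fun a' ha' y hy => ?_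
    rw [Submodule.mem_comap, LinearMap.mulLeft_apply, ← mul_assoc]
    exact mul_strandM_mem (mul_mem ha ha') hy
  exact this hx

lemma t_pow_mem_strandM {k m : ℕ} (hm : m ≤ d - 1) :
    t (k + 1) ^ m ∈ strandM d g t β (k + 1) := by
  cases k with
  | zero => exact ⟨m, hm, Or.inl rfl⟩
  | succ k => exact Or.inl ⟨m, hm, Or.inl rfl⟩

lemma t_pow_mul_β_mem_strandM {k m : ℕ} (hm : m ≤ d - 1) :
    t (k + 1) ^ m * β (k + 1) ∈ strandM d g t β (k + 1) := by
  cases k with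
  | zero => exact ⟨m, hm, Or.inr rfl⟩
  | succ k => exact Or.inl ⟨m, hm, Or.inr rfl⟩

lemma t_pow_mem_strandProd (h : FramedRels d N g gi t β c c') {k : ℕ} (hk : k < N) (m : ℕ) :
    t (k + 1) ^ m ∈ strandProd K d g t β k := by
  obtain ⟨m', hm', e⟩ := h.t_pow_mod (Nat.succ_pos k) hk m
  rw [e]
  simpa using mul_strandM_mem (K := K) (g := g) (β := β) (one_mem _) (t_pow_mem_strandM hm')

lemma t_pow_mul_β_mem_strandProd (h : FramedRels d N g gi t β c c') {k : ℕ} (hk : k < N)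
    (m : ℕ) : t (k + 1) ^ m * β (k + 1) ∈ strandProd K d g t β k := by
  obtain ⟨m', hm', e⟩ := h.t_pow_mod (Nat.succ_pos k) hk m
  rw [e]
  simpa using mul_strandM_mem (K := K) (g := g) (one_mem _) (t_pow_mul_β_mem_strandM hm')

lemma strandBimod_le_strandProd (h : FramedRels d N g gi t β c c') {k : ℕ} (hk : k + 1 < N)
    (ih : ∀ x ∈ strandAlg K g t (β 1) (k + 1), x ∈ strandProd K d g t β k) :
    strandBimod K g t (β 1) (k + 1) ≤ strandProd K d g t β (k + 1) := by
  refine Submodule.span_le.2 ?_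
  rintro _ ⟨a, ha, a', ha', rfl⟩
  have : strandProd K d g t β k ≤
      (strandProd K d g t β (k + 1)).comap (LinearMap.mulLeft K (a * g (k + 1))) := by
    refine strandProd_le fun w hw y hy => ?_
    have e : a * g (k + 1) * (w * y) = a * w * (g (k + 1) * y) := by
      rw [mul_assoc, mul_mul_eq_of_mul_eq (h.commute_g_of_mem (Nat.lt_succ_self k) hk hw).eq]
      simp only [mul_assoc]
    rw [Submodule.mem_comap, LinearMap.mulLeft_apply, e]
    exact mul_strandM_mem (mul_mem ha (strandAlg_mono g t _ k.le_succ hw))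
      (Or.inr ⟨y, hy, rfl⟩)
  exact this (ih a' ha')

lemma g_mul_t_pow_mul_g_mem (h : FramedRels d N g gi t β c c') {k : ℕ} (hk : k + 1 < N)
    (hJ : strandBimod K g t (β 1) (k + 1) ≤ strandProd K d g t β (k + 1)) (m : ℕ) :
    g (k + 1) * t (k + 1) ^ m * g (k + 1) ∈ strandProd K d g t β (k + 1) := by
  set E := ∑ m ∈ Finset.range d, t (k + 1) ^ m * t (k + 1 + 1) ^ (d - m) with hE
  have hg (x : R) : x * g (k + 1) = x * gi (k + 1) + c • (x * E) := by
    rw [h.gi_eq _ (by omega) hk, mul_sub, mul_smul_comm, sub_add_cancel]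
  have e : g (k + 1) * t (k + 1) ^ m * g (k + 1) =
      t (k + 1 + 1) ^ m + c • (g (k + 1) * t (k + 1) ^ m * E) := by
    rw [hg, ← h.t_succ_pow_g (by omega) hk, mul_assoc,
      h.g_gi _ (by omega) hk, mul_one]
  rw [e]
  exact add_mem (h.t_pow_mem_strandProd hk m) (Submodule.smul_mem _ _ (hJ
    (h.strandBimod_mul_sum_mem (by omega) hk
      (g_mul_mem g t _ (pow_mem (t_mem g t _ (by omega) le_rfl) _)))))

lemma g_mul_t_pow_mul_β_mul_g_mem (h : FramedRels d N g gi t β c c') {k : ℕ} (hk : k + 1 < N)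
    (hJ : strandBimod K g t (β 1) (k + 1) ≤ strandProd K d g t β (k + 1)) (m : ℕ) :
    g (k + 1) * (t (k + 1) ^ m * β (k + 1)) * g (k + 1) ∈ strandProd K d g t β (k + 1) := by
  set E := ∑ m ∈ Finset.range d, t (k + 1) ^ m * t (k + 1 + 1) ^ (d - m) with hE
  have hg (x : R) : x * g (k + 1) = x * gi (k + 1) + c • (x * E) := by
    rw [h.gi_eq _ (by omega) hk, mul_sub, mul_smul_comm, sub_add_cancel]
  have e : g (k + 1) * (t (k + 1) ^ m * β (k + 1)) * g (k + 1) =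
      t (k + 1 + 1) ^ m * β (k + 1 + 1) +
        c • (g (k + 1) * (t (k + 1) ^ m * β (k + 1)) * E) := by
    rw [hg, h.β_succ (k + 1) (by omega),
      ← mul_assoc (g (k + 1)), ← h.t_succ_pow_g (by omega) hk]
    simp only [mul_assoc]
  rw [e]
  exact add_mem (h.t_pow_mul_β_mem_strandProd hk m) (Submodule.smul_mem _ _ (hJ
    (h.strandBimod_mul_sum_mem (by omega) hk
      (g_mul_mem g t _ (mul_mem (pow_mem (t_mem g t _ (by omega) le_rfl) _)
        (h.β_mem (by omega) le_rfl hk.le))))))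

lemma g_mul_strandM_mul_g_mem (h : FramedRels d N g gi t β c c') {k : ℕ} (hk : k + 1 < N)
    (hJ : strandBimod K g t (β 1) (k + 1) ≤ strandProd K d g t β (k + 1)) {y : R}
    (hy : y ∈ strandM d g t β (k + 1)) :
    g (k + 1) * y * g (k + 1) ∈ strandProd K d g t β (k + 1) := by
  cases k with
  | zero =>
    obtain ⟨m, -, rfl | rfl⟩ := hy
    · exact h.g_mul_t_pow_mul_g_mem hk hJ m
    · exact h.g_mul_t_pow_mul_β_mul_g_mem hk hJ m
  | succ k =>
    obtain ⟨m, -, rfl | rfl⟩ | ⟨w, hw, rfl⟩ := hy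
    · exact h.g_mul_t_pow_mul_g_mem hk hJ m
    · exact h.g_mul_t_pow_mul_β_mul_g_mem hk hJ m
    · have hw' := h.strandM_subset (by omega) (by omega) hw
      have e1 := (h.commute_g_of_mem (Nat.lt_succ_self (k + 1)) hk hw').eq
      have e : g (k + 1 + 1) * (g (k + 1) * w) * g (k + 1 + 1) =
          g (k + 1) * g (k + 1 + 1) * (g (k + 1) * w) := by
        rw [mul_assoc, mul_assoc, ← e1]
        have := congrArg (· * w) (h.braid (k + 1) (by omega) hk)
        simpa only [mul_assoc] using this.symm
      rw [e]
      exact hJ (mul_g_mul_mem g t _ (g_mem g t _ (by omega) (by omega))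
        (mul_mem (g_mem g t _ (by omega) (by omega)) (strandAlg_mono g t _ (by omega) hw')))

lemma mul_gen_mem_strandProd_zero (h : FramedRels d N g gi t β c c') (hN : 0 < N) {x y : R}
    (hx : x ∈ strandProd K d g t β 0) (hy : y ∈ strandGens g t (β 1) 1) :
    x * y ∈ strandProd K d g t β 0 := by
  have : strandProd K d g t β 0 ≤ (strandProd K d g t β 0).comap (LinearMap.mulRight K y) := by
    refine strandProd_le fun a ha x hx => ?_
    rw [Submodule.mem_comap, LinearMap.mulRight_apply, mul_assoc]
    refine mul_strandProd_mem ha ?_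
    have ht := fun m => h.t_pow_mem_strandProd (K := K) hN m
    have hb := fun m => h.t_pow_mul_β_mem_strandProd (K := K) hN m
    obtain ⟨-, rfl⟩ | ⟨i, h1, h2, rfl⟩ | ⟨j, h1, h2, rfl⟩ := hy
    · obtain ⟨m, -, rfl | rfl⟩ := hx
      · exact hb m
      · rw [mul_assoc, h.b_sq, mul_add, mul_one, mul_smul_comm, Finset.mul_sum]
        refine add_mem (ht m) (Submodule.smul_mem _ _ (sum_mem fun i _ => ?_))
        rw [← mul_assoc, ← pow_add]
        exact hb _
    · omega
    · obtain rfl : j = 1 := by omega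
      obtain ⟨m, -, rfl | rfl⟩ := hx
      · rw [← pow_succ]
        exact ht _
      · rw [mul_assoc, ← (h.comm_tb 1 le_rfl hN).eq, ← mul_assoc, ← pow_succ]
        exact hb _
  exact this hx

lemma mul_gen_mem_strandProd_succ (h : FramedRels d N g gi t β c c') {k : ℕ} (hk : k + 1 < N)
    (hJ : strandBimod K g t (β 1) (k + 1) ≤ strandProd K d g t β (k + 1)) {x y : R}
    (hx : x ∈ strandProd K d g t β (k + 1)) (hy : y ∈ strandGens g t (β 1) (k + 1 + 1)) :
    x * y ∈ strandProd K d g t β (k + 1) := by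
  have ht := fun m => h.t_pow_mem_strandProd (K := K) hk m
  have hb := fun m => h.t_pow_mul_β_mem_strandProd (K := K) hk m
  have hk0 : 1 ≤ k + 1 := by omega
  have hβ := h.β_mem hk0 (le_refl (k + 1)) hk.le
  have htm := fun m => pow_mem (t_mem (K := K) g t (β 1) hk0 le_rfl) m
  have hcases : (y ∈ strandAlg K g t (β 1) (k + 1) ∧ (y = β 1 ∨ Commute y (β (k + 1 + 1)))) ∨
      y = g (k + 1) ∨ y = t (k + 1 + 1) := by
    obtain ⟨-, rfl⟩ | ⟨i, h1, h2, rfl⟩ | ⟨j, h1, h2, rfl⟩ := hy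
    · exact Or.inl ⟨b_mem g t _ hk0, Or.inl rfl⟩
    · by_cases hi : i = k + 1
      · exact Or.inr (Or.inl (by rw [hi]))
      · exact Or.inl ⟨g_mem g t _ h1 (by omega),
          Or.inr (h.commute_g_β (by omega) hk i h1 (by omega) (by omega) (by omega))⟩
    · by_cases hj : j = k + 1 + 1
      · exact Or.inr (Or.inr (by rw [hj]))
      · exact Or.inl ⟨t_mem g t _ h1 (by omega),
          Or.inr (h.commute_t_β (by omega) hk j h1 (by omega))⟩
  have : strandProd K d g t β (k + 1) ≤
      (strandProd K d g t β (k + 1)).comap (LinearMap.mulRight K y) := by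
    refine strandProd_le fun a ha x hx => ?_
    rw [Submodule.mem_comap, LinearMap.mulRight_apply, mul_assoc]
    refine mul_strandProd_mem ha ?_
    obtain ⟨m, -, rfl | rfl⟩ | ⟨w, hw, rfl⟩ := hx
    · obtain ⟨hyA, -⟩ | rfl | rfl := hcases
      · rw [((h.commute_t_of_mem (Nat.lt_succ_self _) hk hyA).pow_left m).eq]
        exact mul_strandProd_mem hyA (ht m)
      · rw [h.t_succ_pow_g hk0 hk]
        exact hJ (g_mul_mem g t _ (htm m))
      · rw [← pow_succ]
        exact ht _
    · obtain ⟨hyA, rfl | hyc⟩ | rfl | rfl := hcases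
      · have e : t (k + 2) ^ m * β (k + 2) * β 1 = β 1 * (t (k + 2) ^ m * β (k + 2)) +
            t (k + 2) ^ m * (β (k + 2) * β 1 - β 1 * β (k + 2)) := by
          rw [← mul_assoc, ← ((h.comm_tb (k + 2) (by omega) hk).pow_left m).eq, mul_sub]
          simp only [mul_assoc]
          abel
        rw [e]
        exact add_mem (mul_strandProd_mem hyA (hb m))
          (hJ (h.t_pow_mul_strandBimod_mem hk0 hk (h.commutator_mem hk0 hk) m))
      · rw [mul_assoc, ← hyc.eq, ← mul_assoc,
          ((h.commute_t_of_mem (Nat.lt_succ_self _) hk hyA).pow_left m).eq, mul_assoc]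
        exact mul_strandProd_mem hyA (hb m)
      · rw [h.β_succ (k + 1) hk0, mul_assoc, mul_assoc, h.gi_g _ hk0 hk, mul_one, ← mul_assoc,
          h.t_succ_pow_g hk0 hk, mul_assoc]
        exact hJ (g_mul_mem g t _ (mul_mem (htm m) hβ))
      · rw [mul_assoc, ← (h.commute_t_β (by omega) hk (k + 2) (by omega) hk).eq, ← mul_assoc,
          ← pow_succ]
        exact hb _
    · have hw' := h.strandM_subset (by omega) (by omega) hw
      obtain ⟨hyA, -⟩ | rfl | rfl := hcases
      · rw [mul_assoc]
        exact hJ (g_mul_mem g t _ (mul_mem hw' hyA))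
      · exact h.g_mul_strandM_mul_g_mem hk hJ hw
      · simpa using hJ (h.strandBimod_mul_t_pow_mem hk0 hk (g_mul_mem g t _ hw') 1)
  exact this hx

theorem strandAlg_succ_subset_strandProd (h : FramedRels d N g gi t β c c') {k : ℕ} (hk : k < N) :
    ∀ x ∈ strandAlg K g t (β 1) (k + 1), x ∈ strandProd K d g t β k := by
  induction k with
  | zero =>
    exact fun x hx => adjoin_subset_of_mul_right_mem
      (by simpa using h.t_pow_mem_strandProd (K := K) hk 0)
      (fun x hx y hy => h.mul_gen_mem_strandProd_zero hk hx hy) hx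
  | succ k ih =>
    have hJ := h.strandBimod_le_strandProd hk (ih (by omega))
    exact fun x hx => adjoin_subset_of_mul_right_mem
      (by simpa using h.t_pow_mem_strandProd (K := K) hk 0)
      (fun x hx y hy => h.mul_gen_mem_strandProd_succ hk hJ hx hy) hx

theorem strandAlg_subset_span_ofFn (h : FramedRels d N g gi t β c c') {k : ℕ} (hk : k ≤ N) :
    ∀ x ∈ strandAlg K g t (β 1) k, x ∈ Submodule.span K
      {x | ∃ f : Fin k → R, (∀ i : Fin k, f i ∈ strandM d g t β (i.val + 1)) ∧
        x = (List.ofFn f).prod} := by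
  induction k with
  | zero =>
    refine fun x hx => adjoin_subset_of_mul_right_mem ?_ ?_ hx
    · exact Submodule.subset_span ⟨Fin.elim0, fun i => i.elim0, by simp⟩
    · rintro x - y (⟨h1, -⟩ | ⟨i, h1, h2, -⟩ | ⟨j, h1, h2, -⟩) <;> omega
  | succ k ih =>
    intro x hx
    refine strandProd_le (fun a ha y hy => ?_) (h.strandAlg_succ_subset_strandProd hk x hx)
    have := ih (by omega) a ha
    clear ha
    induction this using Submodule.span_induction with
    | mem a ha =>
      obtain ⟨f, hf, rfl⟩ := ha
      refine Submodule.subset_span ⟨Fin.snoc f y, fun i => ?_, ?_⟩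
      · refine Fin.lastCases ?_ (fun i => ?_) i
        · simpa using hy
        · simpa using hf i
      · rw [List.ofFn_succ']
        simp
    | zero => rw [zero_mul]; exact zero_mem _
    | add a b _ _ h1 h2 => rw [add_mul]; exact add_mem h1 h2
    | smul r a _ h1 => rw [smul_mul_assoc]; exact Submodule.smul_mem _ r h1

end FramedRels
end FramedRelations

lemma mkY_eq_of_rel {d n : ℕ} {a b : FA n} (h : YBrel d n a b) : mkY d n a = mkY d n b :=
  RingQuot.mkAlgHom_rel Kf h

lemma eY_eq (d n i : ℕ) : eY d n i =
    (d : Kf)⁻¹ • ∑ m ∈ Finset.range d, tY d n i ^ m * tY d n (i + 1) ^ (d - m) := by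
  simp only [eY, eF, map_smul, map_sum, map_mul, map_pow, tY]

lemma tY_gY {d n i j : ℕ} (h1 : 1 ≤ i) (h2 : i < n) (h3 : 1 ≤ j) (h4 : j ≤ n) :
    tY d n j * gY d n i = gY d n i * tY d n (sAct i j) := by
  have h := mkY_eq_of_rel (YBrel.tg (d := d) i j h1 (by omega) h3 h4)
  simp only [map_mul] at h
  exact h

lemma tY_comm {d n i j : ℕ} (h1 : 1 ≤ i) (h2 : i ≤ n) (h3 : 1 ≤ j) (h4 : j ≤ n) :
    Commute (tY d n i) (tY d n j) := by
  have h := mkY_eq_of_rel (YBrel.tt (d := d) i j h1 h2 h3 h4)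
  simp only [map_mul] at h
  exact h

lemma tY_pow {d n j : ℕ} (h1 : 1 ≤ j) (h2 : j ≤ n) : tY d n j ^ d = 1 := by
  have h := mkY_eq_of_rel (YBrel.td (d := d) j h1 h2)
  simp only [map_pow, map_one] at h
  exact h

lemma tY_self_gY {d n i : ℕ} (h1 : 1 ≤ i) (h2 : i < n) :
    tY d n i * gY d n i = gY d n i * tY d n (i + 1) := by
  simpa [sAct] using tY_gY (d := d) h1 h2 h1 h2.le

lemma tY_succ_gY {d n i : ℕ} (h1 : 1 ≤ i) (h2 : i < n) :
    tY d n (i + 1) * gY d n i = gY d n i * tY d n i := by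
  simpa [sAct] using tY_gY (d := d) h1 h2 i.succ_pos h2

lemma gY_comm_eY {d n i : ℕ} (h1 : 1 ≤ i) (h2 : i < n) :
    gY d n i * eY d n i = eY d n i * gY d n i := by
  have hp (m : ℕ) : tY d n i ^ m * gY d n i = gY d n i * tY d n (i + 1) ^ m :=
    (SemiconjBy.pow_right (tY_self_gY h1 h2).symm m).symm
  have hq (m : ℕ) : tY d n (i + 1) ^ m * gY d n i = gY d n i * tY d n i ^ m :=
    (SemiconjBy.pow_right (tY_succ_gY h1 h2).symm m).symm
  have hc := tY_comm (d := d) h1 h2.le (Nat.succ_pos i) h2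
  have ht := tY_pow (d := d) h1 h2.le
  have hs := tY_pow (d := d) (Nat.succ_pos i) h2
  rw [eY_eq, mul_smul_comm, smul_mul_assoc, Finset.sum_mul]
  congr 1
  have e (m : ℕ) : tY d n i ^ m * tY d n (i + 1) ^ (d - m) * gY d n i =
      gY d n i * (tY d n i ^ (d - m) * tY d n (i + 1) ^ m) := by
    rw [mul_assoc, hq, ← mul_assoc, hp, mul_assoc, (hc.pow_pow _ _).eq]
  simp only [e]
  rw [← Finset.mul_sum]
  congr 1
  have r := Finset.sum_range_reflect
    (fun m => tY d n i ^ m * tY d n (i + 1) ^ (d - m)) (d + 1)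
  rw [Finset.sum_range_succ, Finset.sum_range_succ] at r
  simp only [Nat.add_sub_cancel, Nat.sub_self, Nat.sub_zero, pow_zero, ht, hs, mul_one] at r
  rw [← add_right_cancel r]
  refine Finset.sum_congr rfl fun m hm => ?_
  rw [Nat.sub_sub_self (Finset.mem_range.1 hm).le]

lemma gY_mul_self {d n i : ℕ} (h1 : 1 ≤ i) (h2 : i < n) :
    gY d n i * gY d n i = 1 + (uu - uu⁻¹) • (eY d n i * gY d n i) := by
  have := mkY_eq_of_rel (YBrel.gsq (d := d) i h1 (Nat.le_sub_one_of_lt h2))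
  simp only [map_add, map_one, map_smul, map_mul, pow_two] at this
  exact this

lemma gY_mul_gInv {d n i : ℕ} (h1 : 1 ≤ i) (h2 : i < n) : gY d n i * gInv d n i = 1 := by
  rw [gInv, mul_sub, mul_smul_comm, gY_comm_eY h1 h2, gY_mul_self h1 h2, add_sub_cancel_right]

lemma gInv_mul_gY {d n i : ℕ} (h1 : 1 ≤ i) (h2 : i < n) : gInv d n i * gY d n i = 1 := by
  rw [gInv, sub_mul, smul_mul_assoc, gY_mul_self h1 h2, add_sub_cancel_right]

lemma framedRels_YB {d : ℕ} (hd : 1 ≤ d) (N : ℕ) :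
    FramedRels d N (gY d N) (gInv d N) (tY d N) (bk d N)
      ((uu - uu⁻¹) * (d : Kf)⁻¹) ((vv - vv⁻¹) * (d : Kf)⁻¹) where
  one_le_d := hd
  comm_gg i j h1 h2 h3 h4 h5 := by
    have h := mkY_eq_of_rel (YBrel.gg (d := d) (n := N) i j h1 (by omega) h3 (by omega) (Or.inl h5))
    simp only [map_mul] at h
    exact h
  braid i h1 h2 := by
    have h := mkY_eq_of_rel (YBrel.braid (d := d) (n := N) i h1 (by omega))
    simp only [map_mul] at h
    exact h
  comm_bg i h1 h2 := by
    have h := mkY_eq_of_rel (YBrel.bg (d := d) (n := N) i h1 (by omega))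
    simp only [map_mul] at h
    exact h
  bgbg := by
    have h := mkY_eq_of_rel (YBrel.bgbg (d := d) (n := N))
    simp only [map_mul] at h
    exact h
  comm_tt i j h1 h2 h3 h4 := tY_comm h1 h2 h3 h4
  tg_self i h1 h2 := tY_self_gY h1 h2
  tg_succ i h1 h2 := tY_succ_gY h1 h2
  comm_tg i j h1 h2 h3 h4 h5 h6 := by
    have h := tY_gY (d := d) h1 h2 h3 h4
    rw [sAct, if_neg h5, if_neg h6] at h
    exact h
  comm_tb j h1 h2 := by
    have h := mkY_eq_of_rel (YBrel.tb (d := d) (n := N) j h1 h2)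
    simp only [map_mul] at h
    exact h
  t_pow j h1 h2 := tY_pow h1 h2
  g_gi i h1 h2 := gY_mul_gInv h1 h2
  gi_g i h1 h2 := gInv_mul_gY h1 h2
  gi_eq i h1 h2 := by rw [gInv, eY_eq, smul_smul]
  b_sq := by
    have := mkY_eq_of_rel (YBrel.bsq (d := d) (n := N))
    simp only [map_pow, map_add, map_one, map_smul, map_mul, fF, map_sum, pow_two] at this
    rw [smul_mul_assoc, smul_smul, Finset.sum_mul] at this
    exact this
  β_succ k hk := by
    obtain ⟨k, rfl⟩ : ∃ l, k = l + 1 := ⟨k - 1, by omega⟩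
    rfl

lemma Mset_eq_strandM (d n k : ℕ) : Mset d n k = strandM d (gY d n) (tY d n) (bk d n) k := by
  induction k using Nat.strong_induction_on with
  | h k ih =>
    match k with
    | 0 => rfl
    | 1 => rfl
    | k + 2 => rw [Mset, strandM, ih (k + 1) (by omega)]

/-- The subalgebra of `Y_{d,n}^B` on the first `k` strands. -/
abbrev subY (d n k : ℕ) : Subalgebra Kf (YB d n) :=
  strandAlg Kf (gY d n) (tY d n) (bk d n 1) k

lemma subY_self (d n : ℕ) (hn : 1 ≤ n) : subY d n n = ⊤ := by
  refine eq_top_iff.2 fun x _ => ?_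
  obtain ⟨a, rfl⟩ := RingQuot.mkAlgHom_surjective Kf (YBrel d n) x
  change mkY d n a ∈ _
  induction a using FreeAlgebra.induction with
  | grade0 r => rw [AlgHom.commutes]; exact Subalgebra.algebraMap_mem _ r
  | grade1 y =>
    cases y with
    | b => exact FramedRels.b_mem _ _ _ hn
    | g i =>
      have := FramedRels.g_mem (K := Kf) (gY d n) (tY d n) (bk d n 1) (Nat.succ_pos i.1)
        (show i.1 + 1 < n by omega)
      have e : gY d n (i.1 + 1) = mkY d n (FreeAlgebra.ι Kf (Gen.g i)) := by
        rw [gY, Gg, dif_pos (by omega)]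
        rfl
      rwa [e] at this
    | t j =>
      have := FramedRels.t_mem (K := Kf) (gY d n) (tY d n) (bk d n 1) (Nat.succ_pos j.1)
        (show j.1 + 1 ≤ n by omega)
      have e : tY d n (j.1 + 1) = mkY d n (FreeAlgebra.ι Kf (Gen.t j)) := by
        rw [tY, Tt, dif_pos (by omega)]
        rfl
      rwa [e] at this
  | mul a b ha hb => rw [map_mul]; exact mul_mem (ha trivial) (hb trivial)
  | add a b ha hb => rw [map_add]; exact add_mem (ha trivial) (hb trivial)

lemma span_Cset {d n : ℕ} (hd : 1 ≤ d) (hn : 1 ≤ n) (w : YB d n) :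
    w ∈ Submodule.span Kf (Cset d n) := by
  have := (framedRels_YB hd n).strandAlg_subset_span_ofFn le_rfl w
    (by rw [show strandAlg Kf _ _ _ _ = ⊤ from subY_self d n hn]; trivial)
  simpa only [Cset, Mset_eq_strandM] using this

namespace IsIncl

variable {d p : ℕ} {inc : YB d p →ₐ[Kf] YB d (p + 1)}

lemma map_eY (h : IsIncl d p inc) {i : ℕ} (h1 : 1 ≤ i) (h2 : i < p) :
    inc (eY d p i) = eY d (p + 1) i := by
  rw [eY_eq, eY_eq, map_smul, map_sum]
  congr 1
  refine Finset.sum_congr rfl fun m _ => ?_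
  rw [map_mul, map_pow, map_pow, h.2.2 i h1 h2.le, h.2.2 (i + 1) i.succ_pos h2]

lemma map_gInv (h : IsIncl d p inc) {i : ℕ} (h1 : 1 ≤ i) (h2 : i < p) :
    inc (gInv d p i) = gInv d (p + 1) i := by
  rw [gInv, gInv, map_sub, map_smul, h.map_eY h1 h2, h.2.1 i h1 (by omega)]

lemma map_bk (h : IsIncl d p inc) {k : ℕ} (h1 : 1 ≤ k) (h2 : k ≤ p) :
    inc (bk d p k) = bk d (p + 1) k := by
  induction k, h1 using Nat.le_induction with
  | base => exact h.1
  | succ k hk ih =>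
    obtain ⟨k, rfl⟩ : ∃ l, k = l + 1 := ⟨k - 1, by omega⟩
    rw [bk, bk, map_mul, map_mul, ih (by omega), h.2.1 _ hk (by omega), h.map_gInv hk (by omega)]

lemma map_gRange (h : IsIncl d p inc) {j k : ℕ} (h1 : 1 ≤ j) (h2 : k ≤ p) :
    inc (gRange d p j k) = gRange d (p + 1) j k := by
  rw [gRange, gRange, map_list_prod, List.map_map]
  congr 1
  refine List.map_congr_left fun i hi => ?_
  rw [List.mem_reverse, List.mem_range'_1] at hi
  exact h.2.1 i (by omega) (by omega)

lemma map_mPlus (h : IsIncl d p inc) {j k : ℕ} (h1 : 1 ≤ j) (h2 : j ≤ k) (h3 : k ≤ p) (m : ℕ) :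
    inc (mPlus d p k j m) = mPlus d (p + 1) k j m := by
  unfold mPlus
  split_ifs
  · rw [map_pow, h.2.2 k (by omega) h3]
  · rw [map_mul, map_pow, h.map_gRange h1 h3, h.2.2 j h1 (by omega)]

lemma map_mMinus (h : IsIncl d p inc) {j k : ℕ} (h1 : 1 ≤ j) (h2 : j ≤ k) (h3 : k ≤ p) (m : ℕ) :
    inc (mMinus d p k j m) = mMinus d (p + 1) k j m := by
  unfold mMinus
  split_ifs
  · rw [map_mul, map_pow, h.map_bk (by omega) h3, h.2.2 k (by omega) h3]
  · rw [map_mul, map_mul, map_pow, h.map_gRange h1 h3, h.map_bk h1 (by omega),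
      h.2.2 j h1 (by omega)]

lemma map_mem_subY (h : IsIncl d p inc) {k : ℕ} (hk : k ≤ p) {w : YB d p} (hw : w ∈ subY d p k) :
    inc w ∈ subY d (p + 1) k := by
  have : subY d p k ≤ (subY d (p + 1) k).comap inc := by
    refine Algebra.adjoin_le ?_
    rintro x (⟨h1, rfl⟩ | ⟨i, h1, h2, rfl⟩ | ⟨j, h1, h2, rfl⟩) <;>
      rw [SetLike.mem_coe, Subalgebra.mem_comap]
    · rw [h.map_bk le_rfl (by omega)]
      exact FramedRels.b_mem _ _ _ h1
    · rw [h.2.1 i h1 (by omega)]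
      exact FramedRels.g_mem _ _ _ h1 h2
    · rw [h.2.2 j h1 (by omega)]
      exact FramedRels.t_mem _ _ _ h1 h2
  exact this hw

lemma exists_of_mem_subY (h : IsIncl d p inc) {x : YB d (p + 1)} (hx : x ∈ subY d (p + 1) p) :
    ∃ w, inc w = x := by
  have : subY d (p + 1) p ≤ inc.range := by
    refine Algebra.adjoin_le ?_
    rintro x (⟨h1, rfl⟩ | ⟨i, h1, h2, rfl⟩ | ⟨j, h1, h2, rfl⟩)
    · exact ⟨_, h.map_bk le_rfl h1⟩
    · exact ⟨_, h.2.1 i h1 (by omega)⟩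
    · exact ⟨_, h.2.2 j h1 h2⟩
  exact this hx

end IsIncl

lemma gRange_succ (d n : ℕ) {j k : ℕ} (h : j ≤ k) :
    gRange d n j (k + 1) = gY d n k * gRange d n j k := by
  rw [gRange, gRange, Nat.sub_add_comm h, List.range'_concat, List.reverse_append]
  simp [h]

lemma gY_mul_mPlus (d n : ℕ) {j k : ℕ} (h : j ≤ k) (m : ℕ) :
    gY d n k * mPlus d n k j m = mPlus d n (k + 1) j m := by
  rw [mPlus, mPlus, if_neg (by omega : j ≠ k + 1), gRange_succ d n h]
  split_ifs with hj
  · subst hj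
    simp [gRange]
  · rw [mul_assoc]

lemma gY_mul_mMinus {d n : ℕ} (hd : 1 ≤ d) {j k : ℕ} (h1 : 1 ≤ j) (h : j ≤ k) (hk : k ≤ n)
    (m : ℕ) : gY d n k * mMinus d n k j m = mMinus d n (k + 1) j m := by
  rw [mMinus, mMinus, if_neg (by omega : j ≠ k + 1), gRange_succ d n h]
  split_ifs with hj
  · subst hj
    rw [(((framedRels_YB hd n).commute_t_β h1 hk j h1 hk).pow_left m).eq]
    simp [gRange]
  · rw [mul_assoc]

lemma exists_eq_of_mem_Mset {d n : ℕ} (hd : 1 ≤ d) {k : ℕ} (h1 : 1 ≤ k) (h2 : k ≤ n)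
    {x : YB d n} (hx : x ∈ Mset d n k) :
    ∃ j m, 1 ≤ j ∧ j ≤ k ∧ m ≤ d - 1 ∧ (x = mPlus d n k j m ∨ x = mMinus d n k j m) := by
  induction k, h1 using Nat.le_induction generalizing x with
  | base =>
    obtain ⟨m, hm, hx⟩ := hx
    refine ⟨1, m, le_rfl, le_rfl, hm, ?_⟩
    rwa [mPlus, mMinus, if_pos rfl, if_pos rfl]
  | succ k hk ih =>
    obtain ⟨k, rfl⟩ : ∃ l, k = l + 1 := ⟨k - 1, by omega⟩
    obtain ⟨m, hm, hx⟩ | ⟨y, hy, rfl⟩ := hx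
    · refine ⟨k + 2, m, by omega, le_rfl, hm, ?_⟩
      rwa [mPlus, mMinus, if_pos rfl, if_pos rfl]
    · obtain ⟨j, m, h3, h4, hm, rfl | rfl⟩ := ih (by omega) hy
      · exact ⟨j, m, h3, by omega, hm, Or.inl (gY_mul_mPlus d n h4 m)⟩
      · exact ⟨j, m, h3, by omega, hm, Or.inr (gY_mul_mMinus hd h3 h4 (by omega) m)⟩

/-- The relative trace sends `w g_p w'` to `z w w'` for all `w`, `w'` in `Y_{d,p}^B`. -/
lemma IsRelTrace.map_mul_gY_mul {d p : ℕ} (hd : 1 ≤ d) (hp : 1 ≤ p) {x y : ZMod d → Kf}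
    {inc : YB d p →ₐ[Kf] YB d (p + 1)} (hinc : IsIncl d p inc)
    {tr : YB d (p + 1) →ₗ[Kf] YB d p} (htr : IsRelTrace d x y p inc tr) (w w' : YB d p) :
    tr (inc w * gY d (p + 1) p * inc w') = zz • (w * w') := by
  obtain ⟨q, rfl⟩ : ∃ q, p = q + 1 := ⟨p - 1, by omega⟩
  have hbasis (a : YB d (q + 1)) {b : YB d (q + 1)} (hb : b ∈ Mset d (q + 1) (q + 1)) :
      tr (inc a * (gY d (q + 1 + 1) (q + 1) * inc b)) = zz • (a * b) := by
    have ha := span_Cset hd hp a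
    induction ha using Submodule.span_induction with
    | mem a ha =>
      obtain ⟨j, m, h1, h2, hm, rfl | rfl⟩ := exists_eq_of_mem_Mset hd hp le_rfl hb
      · rw [hinc.map_mPlus h1 h2 le_rfl, gY_mul_mPlus _ _ h2]
        exact ((htr a ha m hm).2.2 j h1 h2).1
      · rw [hinc.map_mMinus h1 h2 le_rfl, gY_mul_mMinus hd h1 h2 (by omega)]
        exact ((htr a ha m hm).2.2 j h1 h2).2
    | zero => simp only [map_zero, zero_mul, smul_zero]
    | add a a' _ _ h1 h2 => simp only [map_add, add_mul, h1, h2, smul_add]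
    | smul r a _ h1 => simp only [map_smul, smul_mul_assoc, h1, smul_comm zz r]
  have hle : FramedRels.strandProd Kf d (gY d (q + 1)) (tY d (q + 1)) (bk d (q + 1)) q ≤
      LinearMap.ker (tr ∘ₗ LinearMap.mulLeft Kf (inc w * gY d (q + 1 + 1) (q + 1)) ∘ₗ
        inc.toLinearMap - zz • LinearMap.mulLeft Kf w) := by
    refine FramedRels.strandProd_le fun a ha b hb => ?_
    rw [← Mset_eq_strandM] at hb
    have hc := ((framedRels_YB hd (q + 1 + 1)).commute_g_of_mem (Nat.lt_succ_self q)
      (Nat.lt_succ_self _) (hinc.map_mem_subY q.le_succ ha)).eq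
    have e : inc w * gY d (q + 1 + 1) (q + 1) * inc (a * b) =
        inc (w * a) * (gY d (q + 1 + 1) (q + 1) * inc b) := by
      rw [map_mul, map_mul, mul_assoc, mul_mul_eq_of_mul_eq hc]
      simp only [mul_assoc]
    rw [LinearMap.mem_ker, LinearMap.sub_apply, sub_eq_zero]
    change tr (inc w * gY d (q + 1 + 1) (q + 1) * inc (a * b)) = zz • (w * (a * b))
    rw [e, hbasis _ hb, mul_assoc]
  have := hle ((framedRels_YB hd (q + 1)).strandAlg_succ_subset_strandProd (Nat.lt_succ_self q) w'
    (by rw [show strandAlg Kf _ _ _ _ = ⊤ from subY_self d (q + 1) hp]; trivial))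
  rw [LinearMap.mem_ker, LinearMap.sub_apply, sub_eq_zero] at this
  exact this

/-- with `n = p + 1`, so `n ≥ 2`: for every `X ∈ Y_{d,n}^B`,
`tr_n(X t_n) = tr_n(t_n X)`. -/
theorem stmt13 (d p : ℕ) (hd : 1 ≤ d) (hp : 1 ≤ p)
    (x y : ZMod d → Kf) (hx0 : x 0 = 1) (hx : ∀ i, x i ≠ 0) (hy : ∀ i, y i ≠ 0)
    (inc : YB d p →ₐ[Kf] YB d (p + 1)) (hinc : IsIncl d p inc)
    (tr : YB d (p + 1) →ₗ[Kf] YB d p) (htr : IsRelTrace d x y p inc tr) :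
    ∀ X : YB d (p + 1),
      tr (X * tY d (p + 1) (p + 1)) = tr (tY d (p + 1) (p + 1) * X) := by
  obtain ⟨q, rfl⟩ : ∃ q, p = q + 1 := ⟨p - 1, by omega⟩
  have R := framedRels_YB hd (q + 1 + 1)
  intro X
  have hX := R.strandAlg_succ_subset_strandProd (Nat.lt_succ_self (q + 1)) X
    (by rw [show strandAlg Kf _ _ _ _ = ⊤ from subY_self d (q + 1 + 1) (by omega)]; trivial)
  have hle : FramedRels.strandProd Kf d (gY d (q + 1 + 1)) (tY d (q + 1 + 1)) (bk d (q + 1 + 1))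
      (q + 1) ≤ LinearMap.ker (tr ∘ₗ LinearMap.mulRight Kf (tY d (q + 1 + 1) (q + 1 + 1)) -
        tr ∘ₗ LinearMap.mulLeft Kf (tY d (q + 1 + 1) (q + 1 + 1))) := by
    refine FramedRels.strandProd_le fun a ha b hb => ?_
    rw [LinearMap.mem_ker, LinearMap.sub_apply, sub_eq_zero]
    change tr (a * b * tY d (q + 1 + 1) (q + 1 + 1)) = tr (tY d (q + 1 + 1) (q + 1 + 1) * (a * b))
    have hta := R.commute_t_of_mem (Nat.lt_succ_self (q + 1)) le_rfl ha
    have htb := R.commute_t_β (by omega) le_rfl (q + 1 + 1) (by omega) le_rfl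
    obtain ⟨m, -, rfl | rfl⟩ | ⟨b, hb, rfl⟩ := hb
    · rw [(hta.mul_right ((Commute.refl _).pow_right m)).eq]
    · rw [(hta.mul_right (((Commute.refl _).pow_right m).mul_right htb)).eq]
    · have hbA := R.strandM_subset (by omega) (by omega) hb
      have htb' := R.commute_t_of_mem (Nat.lt_succ_self (q + 1)) le_rfl hbA
      obtain ⟨w, rfl⟩ := hinc.exists_of_mem_subY ha
      obtain ⟨w', rfl⟩ := hinc.exists_of_mem_subY hbA
      have hT := hinc.2.2 (q + 1) hp le_rfl
      have e1 : inc w * (gY d (q + 1 + 1) (q + 1) * inc w') * tY d (q + 1 + 1) (q + 1 + 1) =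
          inc (w * tY d (q + 1) (q + 1)) * gY d (q + 1 + 1) (q + 1) * inc w' := by
        rw [mul_assoc, mul_assoc, ← htb'.eq, map_mul, hT, mul_assoc (inc w),
          R.tg_self (q + 1) hp (Nat.lt_succ_self _)]
        simp only [mul_assoc]
      have e2 : tY d (q + 1 + 1) (q + 1 + 1) * (inc w * (gY d (q + 1 + 1) (q + 1) * inc w')) =
          inc w * gY d (q + 1 + 1) (q + 1) * inc (tY d (q + 1) (q + 1) * w') := by
        rw [mul_mul_eq_of_mul_eq hta.eq, map_mul, hT,
          mul_mul_eq_of_mul_eq (R.tg_succ (q + 1) hp (Nat.lt_succ_self _))]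
        simp only [mul_assoc]
      rw [e1, e2, htr.map_mul_gY_mul hd hp hinc, htr.map_mul_gY_mul hd hp hinc, mul_assoc]
  have := hle hX
  rw [LinearMap.mem_ker, LinearMap.sub_apply, sub_eq_zero] at this
  exact this
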